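/- Let ψ : ℕ → ℝ⁺ be non-decreasing with ∑_{n=1}^∞ n^{r−1} ψ(n)^{−r} = ∞ for an integer r ≥ 1. Then the set F(r, ψ) = {x ∈ [0,1) : ∃ 1 ≤ k₁ < ⋯ < k_r ≤ n with a_{k_i}(x) ≥ ψ(n) for all i, for infinitely many n} has full Lebesgue measure in [0,1). -/

import Mathlib

open MeasureTheory Filter Set

/-- The Gauss map. -/
noncomputable def gaussMap (x : ℝ) : ℝ := if x = 0 then 0 else 1 / x - ⌊(1 / x : ℝ)⌋

/-- The `k`-th partial quotient of the continued fraction expansion of `x` (for `k ≥ 1`). -/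
noncomputable def cfa (k : ℕ) (x : ℝ) : ℕ := ⌊1 / (gaussMap^[k - 1] x)⌋₊

/-- The set `F(r, ψ)` of points with at least `r` partial quotients `≥ ψ(n)` among the
first `n` terms, for infinitely many `n`. -/
noncomputable def Fset (r : ℕ) (ψ : ℕ → ℝ) : Set ℝ :=
  {x | x ∈ Set.Ico (0 : ℝ) 1 ∧ ∀ N : ℕ, ∃ n ≥ N, ∃ k : Fin r → ℕ,
    StrictMono k ∧ (∀ i, 1 ≤ k i ∧ k i ≤ n) ∧ ∀ i, ψ n ≤ (cfa (k i) x : ℝ)}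

noncomputable def dig (x : ℝ) : ℕ → ℕ := fun i => ⌊1 / (gaussMap^[i] x)⌋₊

noncomputable def gm (s : ℝ) : Measure ℝ :=
  (volume.restrict (Ico (0:ℝ) 1)).withDensity (fun y => ENNReal.ofReal (1 / (1 + s * y) ^ 2))

lemma measurable_gaussMap : Measurable gaussMap := by
  unfold gaussMap
  refine Measurable.ite (measurableSet_singleton 0) measurable_const ?_
  have h : Measurable (fun x : ℝ => 1 / x) := by fun_prop
  exact h.sub (measurable_from_top.comp (Int.measurable_floor.comp h))

lemma measurable_dig (i : ℕ) : Measurable (fun x => dig x i) := by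
  unfold dig
  exact Nat.measurable_floor.comp ((measurable_gaussMap.iterate i).const_div 1)

lemma measurableSet_dig0 (a : ℕ) : MeasurableSet {x | dig x 0 = a} :=
  measurable_dig 0 (measurableSet_singleton a)

lemma gm_apply (s : ℝ) {H : Set ℝ} (hH : MeasurableSet H) :
    gm s H = ∫⁻ y in H ∩ Ico 0 1, ENNReal.ofReal (1 / (1 + s * y) ^ 2) := by
  unfold gm
  rw [withDensity_apply _ hH, Measure.restrict_restrict hH]

lemma gm_apply' (s : ℝ) {H : Set ℝ} (hH : MeasurableSet H) :
    gm s H = ∫⁻ y in H ∩ Icc 0 1, ENNReal.ofReal (1 / (1 + s * y) ^ 2) := by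
  unfold gm
  rw [withDensity_apply _ hH, Measure.restrict_congr_set Ico_ae_eq_Icc, Measure.restrict_restrict hH]

lemma gm_zero : gm 0 = volume.restrict (Ico (0:ℝ) 1) := by
  unfold gm
  simp

lemma gm_finite (s : ℝ) (hs : 0 ≤ s) : IsFiniteMeasure (gm s) := by
  constructor
  rw [gm_apply s MeasurableSet.univ, univ_inter]
  calc _ ≤ ∫⁻ y in Ico (0:ℝ) 1, 1 := by
        refine setLIntegral_mono measurable_const ?_
        intro y hy
        rw [ENNReal.ofReal_le_one]
        have : 0 ≤ s * y := mul_nonneg hs hy.1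
        rw [div_le_one (by positivity)]
        nlinarith
    _ < ⊤ := by simp

lemma branch_eq (a : ℕ) (ha : 1 ≤ a) (H : Set ℝ) :
    ({x | dig x 0 = a} ∩ gaussMap ⁻¹' H) ∩ Icc 0 1
      = (fun z : ℝ => 1 / (a + z)) '' (H ∩ Ico 0 1) := by
  have ha' : (1:ℝ) ≤ a := by exact_mod_cast ha
  ext x
  constructor
  · rintro ⟨⟨h1, h2⟩, hx0, hx1⟩
    simp only [mem_ofPred_eq, dig, Function.iterate_zero, id] at h1
    have hxne : x ≠ 0 := by
      rintro rfl
      simp at h1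
      omega
    have hxp : 0 < 1 / x := by positivity
    have hfl : (⌊(1 / x : ℝ)⌋ : ℝ) = a := by
      rw [← h1, natCast_floor_eq_intCast_floor hxp.le]
    have hg : gaussMap x = 1 / x - a := by
      unfold gaussMap
      rw [if_neg hxne, hfl]
    refine ⟨gaussMap x, ⟨h2, ?_, ?_⟩, ?_⟩
    · rw [hg, ← hfl]; linarith [Int.floor_le (1 / x)]
    · rw [hg, ← hfl]; linarith [Int.lt_floor_add_one (1 / x)]
    · simp [hg]
  · rintro ⟨z, ⟨hz, hz0, hz1⟩, rfl⟩
    have hp : 0 < a + z := by linarith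
    have hfl : ⌊(a + z : ℝ)⌋ = (a : ℤ) := by
      rw [Int.floor_eq_iff]; push_cast; constructor <;> linarith
    refine ⟨⟨?_, ?_⟩, ?_, ?_⟩
    · simp only [mem_ofPred_eq, dig, Function.iterate_zero, id, one_div_one_div]
      rw [Nat.floor_eq_iff hp.le]; constructor <;> linarith
    · simp only [mem_preimage]
      unfold gaussMap
      rw [if_neg (by positivity), one_div_one_div, hfl]
      simpa using hz
    · positivity
    · show 1 / (a + z) ≤ 1
      rw [div_le_one hp]; linarith

lemma gm_key (s : ℝ) (hs : 0 ≤ s) (a : ℕ) (ha : 1 ≤ a) {H : Set ℝ} (hH : MeasurableSet H) :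
    gm s ({x | dig x 0 = a} ∩ gaussMap ⁻¹' H)
      = ENNReal.ofReal (1 / (a + s) ^ 2) * gm (1 / (a + s)) H := by
  have ha' : (1:ℝ) ≤ a := by exact_mod_cast ha
  rw [gm_apply' s ((measurableSet_dig0 a).inter (measurable_gaussMap hH)), branch_eq a ha,
    lintegral_image_eq_lintegral_abs_deriv_mul (f' := fun z => -1 / (a + z) ^ 2)
      (hH.inter measurableSet_Ico), gm_apply _ hH, ← lintegral_const_mul]
  · refine setLIntegral_congr_fun (hH.inter measurableSet_Ico) ?_
    rintro z ⟨hz, hz0, hz1⟩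
    have hp : 0 < a + z := by linarith
    have hq : 0 < a + s := by linarith
    have hq : 0 < a + s + z := by linarith
    simp only []
    rw [← ENNReal.ofReal_mul (by positivity), ← ENNReal.ofReal_mul (by positivity)]
    congr 1
    rw [abs_div, abs_neg, abs_one, abs_of_pos (by positivity)]
    have e1 : 1 + s * (1 / (a + z)) = (a + s + z) / (a + z) := by field_simp; ring
    have e2 : 1 + 1 / (a + s) * z = (a + s + z) / (a + s) := by field_simp
    rw [e1, e2]
    field_simp
  · fun_prop
  · rintro z ⟨hz, hz0, hz1⟩
    have hp : (a + z) ≠ 0 := by positivity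
    have := (((hasDerivAt_id z).const_add (a:ℝ)).inv hp)
    have h2 := this.hasDerivWithinAt (s := H ∩ Ico 0 1)
    simp only [one_div]
    exact h2
  · rintro z ⟨hz, hz0, hz1⟩ w ⟨hw, hw0, hw1⟩ h
    simpa using h

lemma gm_dig0 (s : ℝ) : gm s {x | dig x 0 = 0} = 0 := by
  rw [gm_apply' s (measurableSet_dig0 0)]
  refine setLIntegral_measure_zero _ _ ?_
  refine measure_mono_null (t := {0}) ?_ (by simp)
  rintro x ⟨h, h0, h1⟩
  by_contra hx
  simp only [mem_singleton_iff] at hx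
  simp only [mem_ofPred_eq, dig, Function.iterate_zero, id, Nat.floor_eq_zero] at h
  have : 0 < x := lt_of_le_of_ne h0 (Ne.symm hx)
  rw [div_lt_one this] at h
  linarith

lemma gm_base (s : ℝ) (hs : 0 ≤ s) (t : ℕ) (ht : 1 ≤ t) :
    ENNReal.ofReal (1 / t) * gm s univ ≤ gm s {x | t ≤ dig x 0} := by
  have ht' : (1:ℝ) ≤ t := by exact_mod_cast ht
  have hm : MeasurableSet {x | t ≤ dig x 0} := measurable_dig 0 (measurableSet_Ici (a := t))
  have hsub : (fun z : ℝ => z * (1 / t)) '' (Ioo 0 1) ⊆ {x | t ≤ dig x 0} ∩ Ico 0 1 := by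
    rintro _ ⟨z, ⟨h0, h1⟩, rfl⟩
    have h2 : z * (1 / t) < 1 := by
      rw [mul_one_div, div_lt_one (by linarith)]; linarith
    refine ⟨?_, ?_, h2⟩
    · simp only [mem_ofPred_eq, dig, Function.iterate_zero, id]
      apply Nat.le_floor
      rw [le_div_iff₀ (by positivity)]
      field_simp
      exact h1.le
    · positivity
  rw [gm_apply s hm]
  refine le_trans ?_ (lintegral_mono_set hsub)
  rw [lintegral_image_eq_lintegral_abs_deriv_mul (f' := fun z => 1 / t) measurableSet_Ioo,
    gm_apply _ MeasurableSet.univ, univ_inter, Measure.restrict_congr_set Ioo_ae_eq_Ico.symm,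
    ← lintegral_const_mul]
  · refine setLIntegral_mono' measurableSet_Ioo ?_
    rintro z ⟨h0, h1⟩
    rw [abs_of_pos (by positivity)]
    gcongr
    rw [mul_one_div, div_le_iff₀ (by linarith)]
    nlinarith
  · fun_prop
  · intro z hz
    simpa using ((hasDerivAt_id z).mul_const (1 / (t:ℝ))).hasDerivWithinAt
  · rintro z hz w hw h
    have : (1 / (t:ℝ)) ≠ 0 := by positivity
    exact mul_right_cancel₀ this h

def Det (k : ℕ) (S : Set (ℕ → ℕ)) : Prop :=
  ∀ u v : ℕ → ℕ, (∀ i < k, u i = v i) → u ∈ S → v ∈ S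

def consSeq (a : ℕ) (u : ℕ → ℕ) : ℕ → ℕ
  | 0 => a
  | (i + 1) => u i

def shiftSeq (k : ℕ) (u : ℕ → ℕ) : ℕ → ℕ := fun i => u (i + k)

lemma dig_cons (x : ℝ) : dig x = consSeq (dig x 0) (dig (gaussMap x)) := by
  funext i
  cases i with
  | zero => rfl
  | succ i => rfl

lemma dig_shift (k : ℕ) (x : ℝ) : dig (gaussMap^[k] x) = shiftSeq k (dig x) := by
  funext i
  simp only [dig, shiftSeq, Function.iterate_add_apply]

lemma Det.cons {k : ℕ} {S : Set (ℕ → ℕ)} (h : Det (k + 1) S) (a : ℕ) :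
    Det k {u | consSeq a u ∈ S} := by
  intro u v huv hu
  refine h _ _ ?_ hu
  intro i hi
  cases i with
  | zero => rfl
  | succ i => exact huv i (by omega)

lemma Det.compl {k : ℕ} {S : Set (ℕ → ℕ)} (h : Det k S) : Det k Sᶜ := by
  intro u v huv hu hv
  exact hu (h v u (fun i hi => (huv i hi).symm) hv)

lemma Det.mono {k l : ℕ} {S : Set (ℕ → ℕ)} (h : Det k S) (hkl : k ≤ l) : Det l S :=
  fun u v huv hu => h u v (fun i hi => huv i (by omega)) hu

lemma Det.inter {k : ℕ} {S S' : Set (ℕ → ℕ)} (h : Det k S) (h' : Det k S') : Det k (S ∩ S') :=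
  fun u v huv hu => ⟨h u v huv hu.1, h' u v huv hu.2⟩

lemma Det.shift {k : ℕ} {S : Set (ℕ → ℕ)} (h : Det k S) (l : ℕ) :
    Det (k + l) (shiftSeq l ⁻¹' S) :=
  fun u v huv hu => h _ _ (fun i hi => huv (i + l) (by omega)) hu

lemma decomp (S : Set (ℕ → ℕ)) (k : ℕ) (H : Set ℝ) :
    dig ⁻¹' S ∩ gaussMap^[k + 1] ⁻¹' H = ⋃ a : ℕ, ({x | dig x 0 = a} ∩
      gaussMap ⁻¹' (dig ⁻¹' {u | consSeq a u ∈ S} ∩ gaussMap^[k] ⁻¹' H)) := by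
  ext x
  simp only [mem_inter_iff, mem_preimage, mem_iUnion, mem_ofPred_eq, Function.iterate_succ_apply]
  constructor
  · rintro ⟨h1, h2⟩
    refine ⟨_, rfl, ?_, h2⟩
    rwa [← dig_cons]
  · rintro ⟨a, rfl, h1, h2⟩
    refine ⟨?_, h2⟩
    rwa [← dig_cons] at h1

lemma decomp' (S : Set (ℕ → ℕ)) :
    dig ⁻¹' S = ⋃ a : ℕ, ({x | dig x 0 = a} ∩
      gaussMap ⁻¹' (dig ⁻¹' {u | consSeq a u ∈ S})) := by
  have := decomp S 0 univ
  simpa using this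

lemma Det.measurableSet {k : ℕ} : ∀ {S : Set (ℕ → ℕ)}, Det k S → MeasurableSet (dig ⁻¹' S) := by
  induction k with
  | zero =>
    intro S h
    by_cases hS : S.Nonempty
    · obtain ⟨u, hu⟩ := hS
      have : S = univ := eq_univ_of_forall fun v => h u v (by simp) hu
      simp [this]
    · rw [not_nonempty_iff_eq_empty.1 hS]; simp
  | succ k ih =>
    intro S h
    rw [decomp']
    exact MeasurableSet.iUnion fun a =>
      (measurableSet_dig0 a).inter (measurable_gaussMap (ih (h.cons a)))

lemma gm_sum (s : ℝ) (B : ℕ → Set ℝ) (hB : ∀ a, MeasurableSet (B a)) :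
    gm s (⋃ a : ℕ, ({x | dig x 0 = a} ∩ gaussMap ⁻¹' (B a)))
      = ∑' a : ℕ, gm s ({x | dig x 0 = a} ∩ gaussMap ⁻¹' (B a)) := by
  refine measure_iUnion ?_ fun a => (measurableSet_dig0 a).inter (measurable_gaussMap (hB a))
  intro a b hab
  refine Set.disjoint_left.2 ?_
  rintro x ⟨h1, _⟩ ⟨h2, _⟩
  exact hab (h1.symm.trans h2)

lemma gm_mul_le {H : Set ℝ} (hH : MeasurableSet H) {p : ENNReal}
    (hp : ∀ s : ℝ, 0 ≤ s → gm s H ≤ p * gm s univ) (k : ℕ) :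
    ∀ S : Set (ℕ → ℕ), Det k S → ∀ s : ℝ, 0 ≤ s →
      gm s (dig ⁻¹' S ∩ gaussMap^[k] ⁻¹' H) ≤ p * gm s (dig ⁻¹' S) := by
  induction k with
  | zero =>
    intro S h s hs
    by_cases hS : S.Nonempty
    · obtain ⟨u, hu⟩ := hS
      have : S = univ := eq_univ_of_forall fun v => h u v (by simp) hu
      simpa [this] using hp s hs
    · rw [not_nonempty_iff_eq_empty.1 hS]; simp
  | succ k ih =>
    intro S h s hs
    have hm := fun a => (h.cons a).measurableSet
    have hm' := fun a => (hm a).inter (measurable_gaussMap.iterate k hH)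
    rw [decomp, decomp' S, gm_sum s _ hm, gm_sum s _ hm', ← ENNReal.tsum_mul_left]
    refine ENNReal.tsum_le_tsum fun a => ?_
    rcases Nat.eq_zero_or_pos a with rfl | ha
    · exact (measure_mono_null inter_subset_left (gm_dig0 s)).trans_le zero_le
    · rw [gm_key s hs a ha (hm a), gm_key s hs a ha (hm' a), mul_left_comm]
      gcongr
      exact ih _ (h.cons a) _ (by positivity)

lemma le_gm_mul {H : Set ℝ} (hH : MeasurableSet H) {p : ENNReal}
    (hp : ∀ s : ℝ, 0 ≤ s → p * gm s univ ≤ gm s H) (k : ℕ) :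
    ∀ S : Set (ℕ → ℕ), Det k S → ∀ s : ℝ, 0 ≤ s →
      p * gm s (dig ⁻¹' S) ≤ gm s (dig ⁻¹' S ∩ gaussMap^[k] ⁻¹' H) := by
  induction k with
  | zero =>
    intro S h s hs
    by_cases hS : S.Nonempty
    · obtain ⟨u, hu⟩ := hS
      have : S = univ := eq_univ_of_forall fun v => h u v (by simp) hu
      simpa [this] using hp s hs
    · rw [not_nonempty_iff_eq_empty.1 hS]; simp
  | succ k ih =>
    intro S h s hs
    have hm := fun a => (h.cons a).measurableSet
    have hm' := fun a => (hm a).inter (measurable_gaussMap.iterate k hH)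
    rw [decomp, decomp' S, gm_sum s _ hm, gm_sum s _ hm', ← ENNReal.tsum_mul_left]
    refine ENNReal.tsum_le_tsum fun a => ?_
    rcases Nat.eq_zero_or_pos a with rfl | ha
    · rw [measure_mono_null inter_subset_left (gm_dig0 s)]; simp
    · rw [gm_key s hs a ha (hm a), gm_key s hs a ha (hm' a), mul_left_comm]
      gcongr
      exact ih _ (h.cons a) _ (by positivity)

lemma pre_shift (k : ℕ) (S S' : Set (ℕ → ℕ)) :
    dig ⁻¹' (S ∩ shiftSeq k ⁻¹' S') = dig ⁻¹' S ∩ gaussMap^[k] ⁻¹' (dig ⁻¹' S') := by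
  ext x
  simp [dig_shift]

def Ub (S : Set (ℕ → ℕ)) (p : ℝ) : Prop :=
  ∀ s : ℝ, 0 ≤ s → gm s (dig ⁻¹' S) ≤ ENNReal.ofReal p * gm s univ

def Lb (S : Set (ℕ → ℕ)) (p : ℝ) : Prop :=
  ∀ s : ℝ, 0 ≤ s → ENNReal.ofReal p * gm s univ ≤ gm s (dig ⁻¹' S)

lemma Ub.inter {k l : ℕ} {S S' : Set (ℕ → ℕ)} {p q : ℝ} (hS : Det k S) (hS' : Det l S')
    (h : Ub S p) (h' : Ub S' q) (hq : 0 ≤ q) : Ub (S ∩ shiftSeq k ⁻¹' S') (q * p) := by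
  intro s hs
  rw [pre_shift, ENNReal.ofReal_mul hq, mul_assoc]
  exact (gm_mul_le hS'.measurableSet h' k S hS s hs).trans (by gcongr; exact h s hs)

lemma Lb.inter {k l : ℕ} {S S' : Set (ℕ → ℕ)} {p q : ℝ} (hS : Det k S) (hS' : Det l S')
    (h : Lb S p) (h' : Lb S' q) (hq : 0 ≤ q) : Lb (S ∩ shiftSeq k ⁻¹' S') (q * p) := by
  intro s hs
  rw [pre_shift, ENNReal.ofReal_mul hq, mul_assoc]
  exact le_trans (by gcongr; exact h s hs) (le_gm_mul hS'.measurableSet h' k S hS s hs)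

lemma real_iff (s : ℝ) (hs : 0 ≤ s) (B : Set ℝ) (hB : MeasurableSet B) (p : ℝ) (hp : 0 ≤ p) :
    (ENNReal.ofReal p * gm s univ ≤ gm s B ↔ p * (gm s).real univ ≤ (gm s).real B) ∧
    (gm s B ≤ ENNReal.ofReal p * gm s univ ↔ (gm s).real B ≤ p * (gm s).real univ) := by
  have := gm_finite s hs
  rw [← ofReal_measureReal (μ := gm s) (s := univ), ← ofReal_measureReal (μ := gm s) (s := B),
    ← ENNReal.ofReal_mul hp, ENNReal.ofReal_le_ofReal_iff measureReal_nonneg,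
    ENNReal.ofReal_le_ofReal_iff (by positivity)]
  exact ⟨Iff.rfl, Iff.rfl⟩

lemma Lb.compl {k : ℕ} {S : Set (ℕ → ℕ)} {p : ℝ} (hS : Det k S) (h : Lb S p) (hp : 0 ≤ p)
    (hp1 : p ≤ 1) : Ub Sᶜ (1 - p) := by
  intro s hs
  have := gm_finite s hs
  have hm := hS.measurableSet
  rw [preimage_compl, (real_iff s hs _ hm.compl _ (by linarith)).2, measureReal_compl hm]
  have := (real_iff s hs _ hm _ hp).1.1 (h s hs)
  linarith

lemma Ub.compl {k : ℕ} {S : Set (ℕ → ℕ)} {p : ℝ} (hS : Det k S) (h : Ub S p) (hp : 0 ≤ p)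
    (hp1 : p ≤ 1) : Lb Sᶜ (1 - p) := by
  intro s hs
  have := gm_finite s hs
  have hm := hS.measurableSet
  rw [preimage_compl, (real_iff s hs _ hm.compl _ (by linarith)).1, measureReal_compl hm]
  have := (real_iff s hs _ hm _ hp).2.1 (h s hs)
  linarith

lemma Ub.mono {S : Set (ℕ → ℕ)} {p q : ℝ} (h : Ub S p) (hpq : p ≤ q) : Ub S q :=
  fun s hs => (h s hs).trans (by gcongr)

lemma Ub_univ : Ub univ 1 := by
  intro s hs
  simp

lemma Lb_univ : Lb univ 1 := by
  intro s hs
  simp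

def Hit (L t : ℕ) : Set (ℕ → ℕ) := {u | ∃ i < L, t ≤ u i}

lemma det_hit (L t : ℕ) : Det L (Hit L t) := by
  rintro u v huv ⟨i, hi, h⟩
  exact ⟨i, hi, by rwa [← huv i hi]⟩

lemma nohit_ub (t : ℕ) (ht : 1 ≤ t) (L : ℕ) : Ub (Hit L t)ᶜ ((1 - 1 / (t:ℝ)) ^ L) := by
  have ht' : (1:ℝ) ≤ t := by exact_mod_cast ht
  have h0 : (0:ℝ) ≤ 1 - 1 / (t:ℝ) := by
    rw [sub_nonneg, div_le_one (by linarith)]; exact ht'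
  induction L with
  | zero => simpa [Hit] using Ub_univ
  | succ L ih =>
    have e : (Hit (L + 1) t)ᶜ = (Hit 1 t)ᶜ ∩ shiftSeq 1 ⁻¹' (Hit L t)ᶜ := by
      rw [← compl_inj_iff]
      ext u
      simp only [Hit, compl_inter, compl_compl, mem_union, preimage_compl, mem_preimage, shiftSeq,
        mem_ofPred_eq]
      constructor
      · rintro ⟨i, hi, h⟩
        cases i with
        | zero => exact Or.inl ⟨0, by omega, h⟩
        | succ i => exact Or.inr ⟨i, by omega, h⟩
      · rintro (⟨i, hi, h⟩ | ⟨i, hi, h⟩)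
        · exact ⟨i, by omega, h⟩
        · exact ⟨i + 1, by omega, h⟩
    rw [e, pow_succ]
    refine Ub.inter (det_hit 1 t).compl (det_hit L t).compl ?_ ih (by positivity)
    refine Lb.compl (det_hit 1 t) ?_ (by positivity) (by linarith)
    intro s hs
    have : dig ⁻¹' Hit 1 t = {x | t ≤ dig x 0} := by
      ext x
      simp [Hit]
    rw [this]
    exact gm_base s hs t ht

lemma real_aux (t : ℕ) (ht : 1 ≤ t) (L : ℕ) :
    (1 - 1 / (t:ℝ)) ^ L ≤ 1 - (L:ℝ) / (L + t) := by
  have ht' : (1:ℝ) ≤ t := by exact_mod_cast ht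
  have hL : (0:ℝ) ≤ L := by positivity
  have h0 : (0:ℝ) ≤ 1 - 1 / (t:ℝ) := by
    rw [sub_nonneg, div_le_one (by linarith)]; exact ht'
  have e : 1 - (L:ℝ) / (L + t) = 1 / (1 + L * (1 / t)) := by field_simp; ring
  rw [e, le_div_iff₀ (by positivity)]
  have hb : 1 + (L:ℝ) * (1 / t) ≤ (1 + 1 / t) ^ L :=
    one_add_mul_le_pow (by have : (0:ℝ) ≤ 1 / t := by positivity
                           linarith) L
  calc _ ≤ (1 - 1 / (t:ℝ)) ^ L * (1 + 1 / t) ^ L := by gcongr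
    _ = ((1 - 1 / (t:ℝ)) * (1 + 1 / t)) ^ L := by rw [mul_pow]
    _ ≤ 1 := by
      apply pow_le_one₀
      · positivity
      · nlinarith [sq_nonneg (1 / (t:ℝ))]

lemma hit_lb (t : ℕ) (ht : 1 ≤ t) (L : ℕ) : Lb (Hit L t) ((L:ℝ) / (L + t)) := by
  have ht' : (1:ℝ) ≤ t := by exact_mod_cast ht
  have h1 : (L:ℝ) / (L + t) ≤ 1 := by
    rw [div_le_one (by positivity)]; linarith
  have h2 : (0:ℝ) ≤ (L:ℝ) / (L + t) := by positivity
  have := ((nohit_ub t ht L).mono (real_aux t ht L)).compl (det_hit L t).compl (by linarith)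
    (by linarith)
  simpa using this

def MHit (L t c : ℕ) : Set (ℕ → ℕ) := {u | ∀ d < c, ∃ i < L, t ≤ u (d * L + i)}

lemma det_mhit (L t c : ℕ) : Det (c * L) (MHit L t c) := by
  intro u v huv h d hd
  obtain ⟨i, hi, h⟩ := h d hd
  refine ⟨i, hi, ?_⟩
  rwa [← huv]
  calc d * L + i < (d + 1) * L := by rw [add_mul]; omega
    _ ≤ c * L := Nat.mul_le_mul_right _ hd

lemma mhit_lb (t : ℕ) (ht : 1 ≤ t) (L c : ℕ) : Lb (MHit L t c) (((L:ℝ) / (L + t)) ^ c) := by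
  induction c with
  | zero => simpa [MHit] using Lb_univ
  | succ c ih =>
    have e : MHit L t (c + 1) = Hit L t ∩ shiftSeq L ⁻¹' MHit L t c := by
      ext u
      simp only [MHit, Hit, mem_inter_iff, mem_preimage, mem_ofPred_eq, shiftSeq]
      constructor
      · intro h
        refine ⟨by simpa using h 0 (by omega), fun d hd => ?_⟩
        obtain ⟨i, hi, h⟩ := h (d + 1) (by omega)
        refine ⟨i, hi, ?_⟩
        convert h using 2
        ring
      · rintro ⟨h1, h2⟩ d hd
        cases d with
        | zero => simpa using h1
        | succ d =>
          obtain ⟨i, hi, h⟩ := h2 d (by omega)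
          refine ⟨i, hi, ?_⟩
          convert h using 2
          ring
    rw [e, pow_succ]
    exact Lb.inter (det_hit L t) (det_mhit L t c) (hit_lb t ht L) ih (by positivity)

def Bad (r : ℕ) (t : ℕ → ℕ) (J N : ℕ) : Set (ℕ → ℕ) :=
  {u | ∀ j < N, shiftSeq (r * 2 ^ (J + j)) u ∉ MHit (2 ^ (J + j)) (t (J + j)) r}

lemma bad_succ (r : ℕ) (t : ℕ → ℕ) (J N : ℕ) : Bad r t J (N + 1) =
    Bad r t J N ∩ shiftSeq (r * 2 ^ (J + N)) ⁻¹' (MHit (2 ^ (J + N)) (t (J + N)) r)ᶜ := by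
  ext u
  simp only [Bad, mem_inter_iff, mem_preimage, mem_ofPred_eq, mem_compl_iff, Nat.lt_succ_iff_lt_or_eq]
  constructor
  · intro h
    exact ⟨fun j hj => h j (Or.inl hj), h N (Or.inr rfl)⟩
  · rintro ⟨h1, h2⟩ j (hj | rfl)
    · exact h1 j hj
    · exact h2

lemma bad_det (r : ℕ) (t : ℕ → ℕ) (J N : ℕ) : Det (r * 2 ^ (J + N)) (Bad r t J N) := by
  induction N with
  | zero => 
    intro u v _ _
    simp [Bad]
  | succ N ih =>
    rw [bad_succ]
    refine (ih.mono ?_).inter (((det_mhit _ _ _).compl.shift _).mono ?_)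
    · gcongr <;> omega
    · rw [← add_assoc, pow_succ]
      apply le_of_eq; ring

noncomputable def qq (r : ℕ) (t : ℕ → ℕ) (j : ℕ) : ℝ :=
  (((2 ^ j : ℕ) : ℝ) / ((2 ^ j : ℕ) + t j)) ^ r

lemma qq_nonneg (r : ℕ) (t : ℕ → ℕ) (j : ℕ) : 0 ≤ qq r t j := by unfold qq; positivity

lemma qq_le_one (r : ℕ) (t : ℕ → ℕ) (j : ℕ) : qq r t j ≤ 1 := by
  unfold qq
  apply pow_le_one₀ (by positivity)
  rw [div_le_one (by positivity)]
  have : (0:ℝ) ≤ t j := by positivity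
  linarith

lemma bad_ub (r : ℕ) (t : ℕ → ℕ) (ht : ∀ j, 1 ≤ t j) (J N : ℕ) :
    Ub (Bad r t J N) (Real.exp (- ∑ j ∈ Finset.range N, qq r t (j + J))) := by
  induction N with
  | zero => simpa [Bad] using Ub_univ
  | succ N ih =>
    rw [bad_succ, Finset.sum_range_succ, neg_add, Real.exp_add, mul_comm (Real.exp _)]
    refine Ub.inter (bad_det r t J N) (det_mhit _ _ _).compl ih ?_ (by positivity)
    have := (mhit_lb (t (J + N)) (ht _) (2 ^ (J + N)) r).compl (det_mhit _ _ _)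
      (qq_nonneg r t (J + N)) (qq_le_one r t (J + N))
    refine this.mono ?_
    rw [add_comm N J]
    have := Real.add_one_le_exp (- qq r t (J + N))
    unfold qq at this ⊢
    linarith

lemma bad_null (r : ℕ) (t : ℕ → ℕ) (ht : ∀ j, 1 ≤ t j) (hq : ¬ Summable (qq r t)) (J : ℕ) :
    volume ({x | ∀ N, dig x ∈ Bad r t J N} ∩ Ico (0:ℝ) 1) = 0 := by
  have hq' : ¬ Summable (fun j => qq r t (j + J)) := by rwa [summable_nat_add_iff]
  rw [not_summable_iff_tendsto_nat_atTop_of_nonneg (fun j => qq_nonneg _ _ _)] at hq'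
  have h1 := Real.tendsto_exp_neg_atTop_nhds_zero.comp hq'
  have h2 := ENNReal.tendsto_ofReal h1
  rw [ENNReal.ofReal_zero] at h2
  refine le_antisymm (ge_of_tendsto' h2 fun N => ?_) zero_le
  have := bad_ub r t ht J N 0 le_rfl
  have e : gm 0 univ = 1 := by simp [gm_zero]
  rw [e, mul_one, gm_zero, Measure.restrict_apply (bad_det r t J N).measurableSet] at this
  refine le_trans (measure_mono ?_) this
  rintro x ⟨h, hx⟩
  exact ⟨h N, hx⟩

lemma summ_aux (r : ℕ) (hr : 1 ≤ r) (ψ : ℕ → ℝ) (hpos : ∀ n, 0 < ψ n) (hmono : Monotone ψ)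
    (h : Summable fun j : ℕ => ((2:ℝ) ^ j / ψ (r * 2 ^ (j + 1))) ^ r) :
    Summable fun n : ℕ => (n : ℝ) ^ (r - 1) / ψ n ^ r := by
  set f : ℕ → ℝ := fun n => (n : ℝ) ^ (r - 1) / ψ n ^ r with hf
  have hf0 : ∀ n, 0 ≤ f n := fun n => by
    have := hpos n
    simp only [hf]; positivity
  set g : ℕ → ℝ := fun j => ((2:ℝ) ^ j / ψ (r * 2 ^ (j + 1))) ^ r with hg
  have hg0 : ∀ n, 0 ≤ g n := fun n => by
    have := hpos (r * 2 ^ (n + 1))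
    simp only [hg]; positivity
  have key : ∀ J, ∑ n ∈ Finset.range (r * 2 ^ (J + 1)), f n ≤
      ∑ n ∈ Finset.range (r * 2), f n + (4 * r) ^ r * ∑ j ∈ Finset.range J, g j := by
    intro J
    induction J with
    | zero => simp
    | succ J ih =>
      have hle : r * 2 ^ (J + 1) ≤ r * 2 ^ (J + 1 + 1) := by gcongr <;> omega
      rw [Finset.sum_range_succ _ J, mul_add, ← add_assoc, ← Finset.sum_range_add_sum_Ico f hle]
      refine add_le_add ih ?_
      have hb : ∀ n ∈ Finset.Ico (r * 2 ^ (J + 1)) (r * 2 ^ (J + 1 + 1)),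
          f n ≤ (4 * r * 2 ^ J) ^ (r - 1) / ψ (r * 2 ^ (J + 1)) ^ r := by
        intro n hn
        rw [Finset.mem_Ico] at hn
        have h1 : (n:ℝ) ≤ 4 * r * 2 ^ J := by
          have : n ≤ 4 * r * 2 ^ J := by
            have e : r * 2 ^ (J + 1 + 1) = 4 * r * 2 ^ J := by ring
            omega
          exact_mod_cast this
        have h2 := hpos (r * 2 ^ (J + 1))
        have h3 := hmono hn.1
        simp only [hf]
        gcongr
      refine (Finset.sum_le_card_nsmul _ _ _ hb).trans ?_
      have hc : (Finset.Ico (r * 2 ^ (J + 1)) (r * 2 ^ (J + 1 + 1))).card = 2 * r * 2 ^ J := by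
        rw [Nat.card_Ico]
        have e : r * 2 ^ (J + 1 + 1) = 2 * r * 2 ^ J + r * 2 ^ (J + 1) := by ring
        omega
      rw [hc, nsmul_eq_mul]
      simp only [hg]
      have h2 := hpos (r * 2 ^ (J + 1))
      rw [div_pow, ← mul_div_assoc, ← mul_div_assoc, ← mul_pow]
      gcongr
      obtain ⟨m, rfl⟩ : ∃ m, r = m + 1 := ⟨r - 1, by omega⟩
      rw [Nat.add_sub_cancel, pow_succ, mul_comm]
      gcongr
      push_cast
      have : (0:ℝ) ≤ (m + 1) * 2 ^ J := by positivity
      linarith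
  refine summable_of_sum_range_le (c := ∑ n ∈ Finset.range (r * 2), f n + (4 * r) ^ r * ∑' j, g j)
    hf0 fun n => ?_
  refine le_trans ?_ ((key n).trans ?_)
  · refine Finset.sum_le_sum_of_subset_of_nonneg ?_ fun i _ _ => hf0 i
    rw [Finset.range_subset_range]
    have : n < 2 ^ n := Nat.lt_two_pow_self
    calc n ≤ 1 * 2 ^ (n + 1) := by rw [pow_succ]; omega
      _ ≤ _ := Nat.mul_le_mul_right _ hr
  · gcongr
    exact h.sum_le_tsum _ fun i _ => hg0 i

noncomputable def tt (r : ℕ) (ψ : ℕ → ℝ) (j : ℕ) : ℕ := ⌈ψ (r * 2 ^ (j + 1))⌉₊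

lemma not_summ_qq (r : ℕ) (hr : 1 ≤ r) (ψ : ℕ → ℝ) (hpos : ∀ n, 0 < ψ n) (hmono : Monotone ψ)
    (hsum : ¬ Summable fun n : ℕ => (n : ℝ) ^ (r - 1) / ψ n ^ r) :
    ¬ Summable (qq r (tt r ψ)) := by
  intro h
  apply hsum
  apply summ_aux r hr ψ hpos hmono
  have h0 := h.tendsto_atTop_zero
  have hev : ∀ᶠ j in atTop, qq r (tt r ψ) j < (1 / 2) ^ r :=
    h0.eventually (gt_mem_nhds (by positivity))
  refine Summable.of_norm_bounded_eventually_nat (g := fun j => 4 ^ r * qq r (tt r ψ) j)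
    (h.mul_left _) ?_
  filter_upwards [hev, eventually_ge_atTop 1] with j hj hj1
  have hp := hpos (r * 2 ^ (j + 1))
  rw [Real.norm_of_nonneg (by positivity)]
  unfold qq at hj ⊢
  rw [← mul_pow]
  have hj2 := lt_of_pow_lt_pow_left₀ r (by norm_num) hj
  have hc := (Nat.ceil_lt_add_one hp.le)
  change (tt r ψ j : ℝ) < _ at hc
  have h2 : (2:ℝ) ≤ 2 ^ j := by
    calc (2:ℝ) = 2 ^ 1 := by norm_num
      _ ≤ 2 ^ j := by gcongr; norm_num
  have ht : (0:ℝ) ≤ tt r ψ j := by positivity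
  push_cast at hj2 ⊢
  rw [div_lt_iff₀ (by positivity)] at hj2
  refine pow_le_pow_left₀ (by positivity) ?_ r
  rw [← mul_div_assoc, div_le_div_iff₀ hp (by positivity)]
  have : (2:ℝ) ^ j + tt r ψ j ≤ 4 * ψ (r * 2 ^ (j + 1)) := by linarith
  nlinarith

lemma mem_of_good (r : ℕ) (hr : 1 ≤ r) (ψ : ℕ → ℝ) (x : ℝ) (hx : x ∈ Ico (0:ℝ) 1)
    (h : ∀ J, ∃ N, dig x ∉ Bad r (tt r ψ) J N) : x ∈ Fset r ψ := by
  refine ⟨hx, fun M => ?_⟩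
  obtain ⟨N, hN⟩ := h M
  simp only [Bad, mem_ofPred_eq, not_forall, not_not] at hN
  obtain ⟨j', -, hj⟩ := hN
  set j := M + j' with hjd
  have hh : ∀ d : Fin r, ∃ i < 2 ^ j, tt r ψ j ≤ dig x (d * 2 ^ j + i + r * 2 ^ j) :=
    fun d => hj d d.2
  choose i hi hit using hh
  refine ⟨r * 2 ^ (j + 1), ?_, fun d => d * 2 ^ j + i d + r * 2 ^ j + 1, ?_, ?_, ?_⟩
  · have : j < 2 ^ j := Nat.lt_two_pow_self
    calc M ≤ 1 * 2 ^ (j + 1) := by rw [pow_succ]; omega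
      _ ≤ _ := Nat.mul_le_mul_right _ hr
  · intro d e hde
    have h1 : (d : ℕ) + 1 ≤ e := hde
    have h2 := Nat.mul_le_mul_right (2 ^ j) h1
    rw [add_mul] at h2
    have := hi d
    show _ + 1 < _ + 1
    omega
  · intro d
    have h1 : (d : ℕ) + 1 ≤ r := d.2
    have h2 := Nat.mul_le_mul_right (2 ^ j) h1
    rw [add_mul] at h2
    have := hi d
    have e : r * 2 ^ (j + 1) = r * 2 ^ j + r * 2 ^ j := by ring
    show 1 ≤ d * 2 ^ j + i d + r * 2 ^ j + 1 ∧ d * 2 ^ j + i d + r * 2 ^ j + 1 ≤ r * 2 ^ (j + 1)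
    constructor
    · omega
    · omega
  · intro d
    exact (Nat.le_ceil _).trans (by exact_mod_cast hit d)

theorem stmt_11 (r : ℕ) (hr : 1 ≤ r) (ψ : ℕ → ℝ) (hpos : ∀ n, 0 < ψ n)
    (hmono : Monotone ψ)
    (hsum : ¬ Summable fun n : ℕ => (n : ℝ) ^ (r - 1) / ψ n ^ r) :
    MeasureTheory.volume (Fset r ψ) = 1 := by
  have hq := not_summ_qq r hr ψ hpos hmono hsum
  have ht : ∀ j, 1 ≤ tt r ψ j := fun j => Nat.one_le_iff_ne_zero.2 (by
    have := hpos (r * 2 ^ (j + 1))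
    have := Nat.ceil_pos.2 this
    unfold tt
    omega)
  have hnull := measure_iUnion_null (bad_null r (tt r ψ) ht hq)
  have h1 : volume (Ico (0:ℝ) 1) = 1 := by simp
  refine le_antisymm ?_ ?_
  · rw [← h1]
    exact measure_mono fun x hx => hx.1
  · rw [← h1, ← add_zero (volume (Fset r ψ)), ← hnull]
    refine le_trans (measure_mono ?_) (measure_union_le _ _)
    intro x hx
    by_cases h : ∀ J, ∃ N, dig x ∉ Bad r (tt r ψ) J N
    · exact Or.inl (mem_of_good r hr ψ x hx h)
    · push Not at h
      obtain ⟨J, hJ⟩ := h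
      exact Or.inr (mem_iUnion.2 ⟨J, hJ, hx⟩)
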